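/- Let G, L₁, L be positive integers; set τ₁ = ⌈L₁/G⌉, τ = ⌈L/G⌉, m = ⌊τ/τ₁⌋ ≥ 1, and τ₂ = τ − mτ₁, and suppose τ₂ > 0. Let K₁, t₁ be positive integers such that τ₁ divides both t₁ and K₁, t₁ + τ₁ < K₁, τ₂ divides t₁ + τ₁, and 2G ≤ binom(t₁+τ₁−1, t₁). Set Λ₁ = binom(K₁−t₁−1, τ₁−1), Λ₂ = binom(t₁+τ₁−1, τ₁−1), Λ₃ = binom(t₁+τ₁−1, τ₂−1). Then there exists a (G, L, mK₁, F, Z, S) MIMO-PDA with F = (G·Λ₁·Λ₃/gcd(G,Λ₂))·(m(t₁+τ₁)/τ₂ + 1)·binom(K₁, t₁), Z = (G·Λ₁·Λ₃/gcd(G,Λ₂))·(m(t₁+τ₁)/τ₂ + 1)·binom(K₁−1, t₁−1), and S = (m·Λ₂·Λ₃/gcd(G,Λ₂))·((t₁+τ₁)/τ₂)·binom(K₁, t₁+τ₁), whose sum-DoF mK₁(F−Z)/S equals min{G·mK₁, G·m·t₁ + G⌈L/G⌉}, i.e., it attains the maximum sum-DoF. -/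

import Mathlib

open Finset

/-- Ceiling division `⌈a / b⌉` on naturals. -/
def cdiv (a b : ℕ) : ℕ := (a + b - 1) / b

/-- `⟨a⟩_q`: the least positive residue of `a` modulo `q` when `q ∤ a`, and `q` when `q ∣ a`. -/
def modRes (a q : ℕ) : ℕ := if q ∣ a then q else a % q

section PDA

variable {α κ σ : Type*} [Fintype α] [Fintype κ] [DecidableEq σ]

/-- The set of integer symbols occurring in the array `P` (the star `*` is `none`). -/
def pdaSymbols (P : α → κ → Option σ) : Finset σ :=
  Finset.univ.biUnion fun f : α => Finset.univ.biUnion fun k : κ => (P f k).toFinset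

/-- The set of columns of the subarray `P^(s)` (columns of `P` containing `s`). -/
def pdaColsOf (P : α → κ → Option σ) (s : σ) : Finset κ :=
  Finset.univ.filter fun k => ∃ f, P f k = some s

/-- `𝒫^{(s)}_f`: the columns of `P^(s)` whose entry in row `f` is an integer. -/
def pdaIntCols (P : α → κ → Option σ) (s : σ) (f : α) : Finset κ :=
  (pdaColsOf P s).filter fun k => P f k ≠ none

/-- A `(G,L,K,F,Z,S)` MIMO placement delivery array: an `F × K` array over `'*'` and
`S` distinct integer symbols satisfying conditions C1–C4. -/
def IsMIMOPDA (G L K F Z S : ℕ) (P : α → κ → Option σ) : Prop :=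
  Fintype.card α = F ∧ Fintype.card κ = K ∧
  -- C2: exactly `S` distinct integers occur, each at least once
  (pdaSymbols P).card = S ∧
  -- C1: each column contains exactly `Z` stars
  (∀ k : κ, (Finset.univ.filter fun f : α => P f k = none).card = Z) ∧
  -- C3: each integer occurs at most `G` times in each column
  (∀ (s : σ) (k : κ), (Finset.univ.filter fun f : α => P f k = some s).card ≤ G) ∧
  -- C4 (a)
  (∀ (s : σ) (f : α), (∃ k, P f k = some s) → (pdaIntCols P s f).card ≤ cdiv L G) ∧
  -- C4 (b)
  (∀ (s : σ) (k : κ) (T : Finset α), T.card = modRes L G + 1 →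
    (∀ f ∈ T, P f k = some s) →
    ∃ f ∈ T, ∃ f' ∈ T, pdaIntCols P s f ≠ pdaIntCols P s f')

/-- The consistency number of an array. -/
noncomputable def consistNum (P : α → κ → Option σ) : ℕ :=
  sSup {μ : ℕ | ∃ (s : σ) (k : κ) (T : Finset α), T.card = μ ∧
    (∀ f ∈ T, P f k = some s) ∧
    ∀ f ∈ T, ∀ f' ∈ T, pdaIntCols P s f = pdaIntCols P s f'}

end PDA

/-- The sum-DoF `K (F - Z) / S` as a rational number. -/
def sumDoF (K F Z S : ℕ) : ℚ := ((K * (F - Z) : ℕ) : ℚ) / (S : ℚ)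

/-- A finite set `A` with `#A = #B * n` on which every fibre of `f` has at most `#B` elements can be
distributed into bins labelled by `B`, with `n` elements in each bin, so that `f` is injective on
every bin. -/
theorem exists_balanced_bins {α β B : Type*} [Fintype B] [Nonempty B] [DecidableEq α]
    [DecidableEq β] [DecidableEq B] (A : Finset α) (f : α → β) (n : ℕ)
    (hcard : A.card = Fintype.card B * n)
    (hfib : ∀ b, (A.filter fun a => f a = b).card ≤ Fintype.card B) :
    ∃ g : α → B, (∀ x, (A.filter fun a => g a = x).card = n) ∧
      ∀ a ∈ A, ∀ a' ∈ A, g a = g a' → f a = f a' → a = a' := by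
  classical
  set J := Fintype.card B with hJ
  let : LinearOrder β := IsWellOrder.linearOrder WellOrderingRel
  let e : A ≃ Fin (n * J) := A.equivFinOfCardEq (by rw [hcard, mul_comm])
  let h : Fin (n * J) → β := fun i => f (e.symm i)
  let σ := Tuple.sort h
  have hmono : Monotone (h ∘ σ) := Tuple.monotone_sort h
  let E : Fin n × B ≃ A :=
    (((Equiv.refl _).prodCongr (Fintype.equivFin B)).trans finProdFinEquiv).trans
      (σ.trans e.symm)
  have hfE : ∀ p, f (E p) = (h ∘ σ) (finProdFinEquiv (p.1, Fintype.equivFin B p.2)) :=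
    fun p => rfl
  refine ⟨fun a => if ha : a ∈ A then (E.symm ⟨a, ha⟩).2 else Classical.arbitrary B, ?_, ?_⟩
  · intro x
    have : (Finset.univ : Finset (Fin n)).card = (A.filter fun a =>
        (if ha : a ∈ A then (E.symm ⟨a, ha⟩).2 else Classical.arbitrary B) = x).card := by
      refine Finset.card_bij (fun i _ => (E (i, x) : α)) ?_ ?_ ?_
      · intro i _
        simp
      · intro i _ i' _ hii
        have := E.injective (Subtype.ext hii)
        exact congrArg Prod.fst this
      · intro a ha
        obtain ⟨haA, hax⟩ := Finset.mem_filter.1 ha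
        rw [dif_pos haA] at hax
        refine ⟨(E.symm ⟨a, haA⟩).1, Finset.mem_univ _, ?_⟩
        have : ((E.symm ⟨a, haA⟩).1, x) = E.symm ⟨a, haA⟩ := by rw [← hax]
        rw [this, Equiv.apply_symm_apply]
    rw [← this, Finset.card_univ, Fintype.card_fin]
  · have key : ∀ (i i' : Fin n) (x : B), i < i' → f (E (i, x)) ≠ f (E (i', x)) := by
      intro i i' x hlt heq
      set y := Fintype.equivFin B x
      rw [hfE, hfE] at heq
      simp only at heq
      have hle : (finProdFinEquiv (i, y)).val + J ≤ (finProdFinEquiv (i', y)).val := by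
        simp only [finProdFinEquiv_apply_val, ← hJ]
        have : J * (i.val + 1) ≤ J * i'.val := Nat.mul_le_mul_left _ hlt
        rw [Nat.mul_succ] at this
        omega
      have hsub : (Finset.Icc (finProdFinEquiv (i, y)) (finProdFinEquiv (i', y))).card ≤
          (A.filter fun a => f a = (h ∘ σ) (finProdFinEquiv (i, y))).card := by
        refine Finset.card_le_card_of_injOn (fun q => (e.symm (σ q) : α)) ?_ ?_
        · intro q hq
          have hq := Finset.mem_Icc.1 hq
          have h1 := hmono hq.1
          have h2 := hmono hq.2
          rw [← heq] at h2
          exact Finset.mem_filter.2 ⟨(e.symm (σ q)).2, le_antisymm h2 h1⟩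
        · intro q _ q' _ hqq
          exact σ.injective (e.symm.injective (Subtype.ext hqq))
      have := hsub.trans (hfib _)
      rw [Fin.card_Icc] at this
      omega
    intro a ha a' ha' hg hf
    simp only [dif_pos ha, dif_pos ha'] at hg
    obtain ⟨⟨i, x⟩, hp⟩ := E.surjective ⟨a, ha⟩
    obtain ⟨⟨i', x'⟩, hp'⟩ := E.surjective ⟨a', ha'⟩
    rw [← hp, ← hp', Equiv.symm_apply_apply, Equiv.symm_apply_apply] at hg
    obtain rfl : x = x' := hg
    have e1 : a = E (i, x) := by rw [hp]
    have e2 : a' = E (i', x) := by rw [hp']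
    rw [e1, e2] at hf ⊢
    rcases lt_trichotomy i i' with hlt | rfl | hlt
    · exact absurd hf (key i i' x hlt)
    · rfl
    · exact absurd hf.symm (key i' i x hlt)

/-- If `#X * c = W * G` and `c ≤ W`, there are `W` subsets of `X` of size `G` covering every element
of `X` exactly `c` times. -/
theorem exists_uniform_cover {α : Type*} [DecidableEq α] (X : Finset α) (c W G : ℕ) (hW : 0 < W)
    (hcard : X.card * c = W * G) (hc : c ≤ W) :
    ∃ 𝒲 : Fin W → Finset α, (∀ w, 𝒲 w ⊆ X) ∧ (∀ w, (𝒲 w).card = G) ∧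
      ∀ x ∈ X, (Finset.univ.filter fun w => x ∈ 𝒲 w).card = c := by
  classical
  have : Nonempty (Fin W) := ⟨⟨0, hW⟩⟩
  obtain ⟨g, hg, hinj⟩ := exists_balanced_bins (B := Fin W)
    (X ×ˢ (Finset.univ : Finset (Fin c))) Prod.fst G
    (by simp [hcard]) (by
      intro b
      refine le_trans (Finset.card_le_card_of_injOn (t := (Finset.univ : Finset (Fin c)))
        Prod.snd (fun _ _ => Finset.mem_coe.2 (Finset.mem_univ _)) ?_) (by simpa using hc)
      intro p hp q hq hpq
      simp only [Finset.coe_filter, Set.mem_ofPred_eq] at hp hq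
      exact Prod.ext (hp.2.trans hq.2.symm) hpq)
  refine ⟨fun w => ((X ×ˢ Finset.univ).filter fun a => g a = w).image Prod.fst, ?_, ?_, ?_⟩
  · intro w x hx
    obtain ⟨p, hp, rfl⟩ := Finset.mem_image.1 hx
    exact (Finset.mem_product.1 (Finset.mem_filter.1 hp).1).1
  · intro w
    rw [Finset.card_image_of_injOn, hg]
    intro p hp q hq hpq
    simp only [Finset.coe_filter, Set.mem_ofPred_eq] at hp hq
    exact hinj p hp.1 q hq.1 (hp.2.trans hq.2.symm) hpq
  · intro x hx
    have : (Finset.univ : Finset (Fin c)).card = (Finset.univ.filter fun w =>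
        x ∈ ((X ×ˢ Finset.univ).filter fun a => g a = w).image Prod.fst).card := by
      refine Finset.card_bij (fun i _ => g (x, i)) ?_ ?_ ?_
      · intro i _
        simp only [Finset.mem_filter, Finset.mem_univ, true_and, Finset.mem_image]
        exact ⟨(x, i), ⟨by simp [hx], rfl⟩, rfl⟩
      · intro i _ i' _ h
        exact congrArg Prod.snd (hinj (x, i) (by simp [hx]) (x, i') (by simp [hx]) h rfl)
      · intro w hw
        simp only [Finset.mem_filter, Finset.mem_univ, true_and, Finset.mem_image] at hw
        obtain ⟨⟨y, i⟩, ⟨_, hgw⟩, rfl⟩ := hw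
        exact ⟨i, Finset.mem_univ _, hgw⟩
    rw [← this, Finset.card_univ, Fintype.card_fin]

/-- On a finite set `X` there is a family of permutations without fixed points, indexed by any
`ι` with `#ι ≤ Q * (#X - 1)`, in which at most `Q` members send a given element to another given
element. -/
theorem exists_spread_derangements {κ ι : Type*} [DecidableEq κ] [Fintype ι] (X : Finset κ)
    (Q : ℕ) (hι : Fintype.card ι ≤ Q * (X.card - 1)) :
    ∃ ψ : ι → Equiv.Perm κ, (∀ r x, ψ r x ∈ X ↔ x ∈ X) ∧ (∀ r, ∀ x ∈ X, ψ r x ≠ x) ∧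
      ∀ x, ∀ y ∈ X, (Finset.univ.filter fun r => ψ r x = y).card ≤ Q := by
  classical
  obtain hM | ⟨M, hM⟩ : X.card = 0 ∨ ∃ M, X.card = M + 1 :=
    (Nat.eq_zero_or_eq_succ_pred _).imp_right fun h => ⟨_, h⟩
  · rw [Finset.card_eq_zero] at hM
    subst hM
    exact ⟨fun _ => 1, by simp, by simp, by simp⟩
  let e : {x // x ∈ X} ≃ Fin (M + 1) := X.equivFinOfCardEq hM
  let i := Fintype.equivFin ι
  have hlt : ∀ r, (i r).val / Q + 1 < M + 1 := by
    intro r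
    have := (i r).2
    rw [hM, Nat.add_sub_cancel] at hι
    have : (i r).val / Q < M := Nat.div_lt_of_lt_mul (this.trans_le hι)
    omega
  let c : ι → Fin (M + 1) := fun r => ⟨(i r).val / Q + 1, hlt r⟩
  let φ : ι → Equiv.Perm {x // x ∈ X} := fun r => (e.trans (Equiv.addRight (c r))).trans e.symm
  have happ : ∀ r x (hx : x ∈ X), Equiv.Perm.ofSubtype (φ r) x = e.symm (e ⟨x, hx⟩ + c r) :=
    fun r x hx => Equiv.Perm.ofSubtype_apply_of_mem _ hx
  refine ⟨fun r => Equiv.Perm.ofSubtype (φ r), ?_, ?_, ?_⟩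
  · intro r x
    exact Equiv.Perm.ofSubtype_apply_mem_iff_mem (φ r) x
  · intro r x hx h
    rw [happ r x hx] at h
    have h' : e.symm (e ⟨x, hx⟩ + c r) = ⟨x, hx⟩ := Subtype.ext h
    rw [Equiv.symm_apply_eq, add_eq_left] at h'
    have := congrArg Fin.val h'
    simp [c] at this
  · intro x y hy
    by_cases hx : x ∈ X
    · rcases Finset.eq_empty_or_nonempty
        (Finset.univ.filter fun r => Equiv.Perm.ofSubtype (φ r) x = y) with h0 | ⟨r₀, hr₀⟩
      · rw [h0]
        simp
      · have hsame : ∀ r, Equiv.Perm.ofSubtype (φ r) x = y → (i r).val / Q = (i r₀).val / Q := by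
          intro r hr
          have hr₀ := (Finset.mem_filter.1 hr₀).2
          rw [← hr₀, happ r x hx, happ r₀ x hx] at hr
          have := congrArg Fin.val (add_left_cancel (e.symm.injective (Subtype.ext hr)))
          simpa [c] using this
        have hQ : 0 < Q := by
          rcases Nat.eq_zero_or_pos Q with rfl | h
          · have := (i r₀).2
            rw [Nat.zero_mul] at hι
            omega
          · exact h
        refine le_trans (Finset.card_le_card_of_injOn
          (t := Finset.Ico ((i r₀).val / Q * Q) ((i r₀).val / Q * Q + Q))
          (fun r => (i r).val) ?_ ?_) (by simp)
        · intro r hr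
          have := hsame r (Finset.mem_filter.1 hr).2
          simp only [Finset.coe_Ico, Set.mem_Ico]
          rw [← this]
          have h1 := Nat.div_add_mod (i r).val Q
          have h2 := Nat.mod_lt (i r).val hQ
          rw [mul_comm] at h1
          omega
        · intro r _ r' _ h
          exact i.injective (Fin.ext h)
    · rw [Finset.card_eq_zero.2]
      · simp
      · refine Finset.filter_eq_empty_iff.2 fun r _ h => hx ?_
        rw [← Equiv.Perm.ofSubtype_apply_mem_iff_mem (φ r) x, h]
        exact hy

/-- A MIMO-PDA from an incidence relation: `Θ` is a type of star patterns, each used for `C` rows,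
`star k T` says that pattern `T` has a star in column `k`, and `Rel s k T` says that symbol `s` is
used in column `k` by one of the rows of pattern `T`. -/
theorem exists_isMIMOPDA_of_rel {α κ σ Θ : Type*} [Fintype α] [Fintype κ] [Fintype σ] [Fintype Θ]
    [DecidableEq σ] {G L C z : ℕ} (hG : 0 < G) (e : α ≃ Θ × Fin C)
    (star : κ → Θ → Prop) (Rel : σ → κ → Θ → Prop)
    [∀ k T, Decidable (star k T)] [∀ s k T, Decidable (Rel s k T)]
    (hstar : ∀ k, (Finset.univ.filter fun T => star k T).card = z)
    (hns : ∀ s k T, Rel s k T → ¬ star k T)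
    (hcount : ∀ k T, ¬ star k T → (Finset.univ.filter fun s => Rel s k T).card = C)
    (hrow : ∀ s k, (Finset.univ.filter fun T => Rel s k T).card ≤ G)
    (hocc : ∀ s, ∃ k T, Rel s k T)
    (hcols : ∀ s k T, Rel s k T →
      ∃ D : Finset κ, D.card ≤ cdiv L G ∧ ∀ k', ¬ star k' T → (∃ T', Rel s k' T') → k' ∈ D)
    (hsep : ∀ s k T T', Rel s k T → Rel s k T' → T ≠ T' →
      ∃ k', (∃ T'', Rel s k' T'') ∧ ¬ star k' T ∧ star k' T') :
    ∃ P : α → κ → Option σ,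
      IsMIMOPDA G L (Fintype.card κ) (Fintype.card α) (C * z) (Fintype.card σ) P := by
  classical
  have henum : ∀ k T, ¬ star k T → Nonempty (Fin C ≃ {s // Rel s k T}) := by
    intro k T h
    refine ⟨Fintype.equivOfCardEq ?_⟩
    rw [Fintype.card_fin, Fintype.card_subtype, hcount k T h]
  let enum : ∀ k T, ¬ star k T → (Fin C ≃ {s // Rel s k T}) :=
    fun k T h => Classical.choice (henum k T h)
  let entry : κ → Θ × Fin C → Option σ := fun k p =>
    if h : star k p.1 then none else some (enum k p.1 h p.2).1
  let P : α → κ → Option σ := fun f k => entry k (e f)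
  have hnone : ∀ f k, P f k = none ↔ star k (e f).1 := by
    intro f k
    by_cases h : star k (e f).1 <;> simp [P, entry, h]
  have hsome : ∀ f k s, P f k = some s → Rel s k (e f).1 := by
    intro f k s hP
    by_cases h : star k (e f).1
    · simp [P, entry, h] at hP
    · simp only [P, entry, h, dite_false, Option.some.injEq] at hP
      rw [← hP]
      exact (enum k (e f).1 h (e f).2).2
  have hex : ∀ s k T, Rel s k T → ∃ f, (e f).1 = T ∧ P f k = some s := by
    intro s k T hR
    have h := hns s k T hR
    refine ⟨e.symm (T, (enum k T h).symm ⟨s, hR⟩), by simp, ?_⟩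
    simp only [P, Equiv.apply_symm_apply]
    simp [entry, h]
  have huniq : ∀ f f' k s, P f k = some s → P f' k = some s → (e f).1 = (e f').1 → f = f' := by
    intro f f' k s hP hP' hT
    have h := hns s k _ (hsome f k s hP)
    have h' := hns s k _ (hsome f' k s hP')
    simp only [P, entry, h, h', dite_false, Option.some.injEq] at hP hP'
    apply e.injective
    generalize e f = p at *
    generalize e f' = p' at *
    obtain ⟨T, c⟩ := p
    obtain ⟨T', c'⟩ := p'
    obtain rfl : T = T' := hT
    have := (enum k T h).injective (Subtype.ext (hP.trans hP'.symm))
    simp only at this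
    rw [this]
  have hcolsOf : ∀ s k, k ∈ pdaColsOf P s ↔ ∃ T, Rel s k T := by
    intro s k
    simp only [pdaColsOf, Finset.mem_filter, Finset.mem_univ, true_and]
    constructor
    · rintro ⟨f, hf⟩
      exact ⟨_, hsome f k s hf⟩
    · rintro ⟨T, hT⟩
      obtain ⟨f, _, hf⟩ := hex s k T hT
      exact ⟨f, hf⟩
  have hint : ∀ s f k, k ∈ pdaIntCols P s f ↔ (∃ T, Rel s k T) ∧ ¬ star k (e f).1 := by
    intro s f k
    rw [pdaIntCols, Finset.mem_filter, hcolsOf, Ne, hnone]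
  refine ⟨P, rfl, rfl, ?_, ?_, ?_, ?_, ?_⟩
  · have : pdaSymbols P = Finset.univ := by
      refine Finset.eq_univ_of_forall fun s => ?_
      obtain ⟨k, T, hR⟩ := hocc s
      obtain ⟨f, _, hf⟩ := hex s k T hR
      simp only [pdaSymbols, Finset.mem_biUnion, Finset.mem_univ, true_and, Option.mem_toFinset]
      exact ⟨f, k, hf⟩
    rw [this, Finset.card_univ]
  · intro k
    rw [← hstar k]
    have : (Finset.univ.filter fun f => P f k = none).card =
        ((Finset.univ.filter fun T => star k T) ×ˢ (Finset.univ : Finset (Fin C))).card :=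
      Finset.card_equiv e (by intro f; simp [hnone])
    rw [this, Finset.card_product, Finset.card_univ, Fintype.card_fin, mul_comm]
  · intro s k
    refine le_trans (Finset.card_le_card_of_injOn (fun f => (e f).1) ?_ ?_) (hrow s k)
    · intro f hf
      have hf := (Finset.mem_filter.1 hf).2
      exact Finset.mem_filter.2 ⟨Finset.mem_univ _, hsome f k s hf⟩
    · intro f hf f' hf' h
      exact huniq f f' k s (Finset.mem_filter.1 hf).2 (Finset.mem_filter.1 hf').2 h
  · rintro s f ⟨k, hk⟩
    obtain ⟨D, hD, hsub⟩ := hcols s k _ (hsome f k s hk)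
    refine le_trans (Finset.card_le_card fun k' hk' => ?_) hD
    rw [hint] at hk'
    exact hsub k' hk'.2 hk'.1
  · intro s k T hT hTs
    have hpos : 0 < modRes L G := by
      unfold modRes
      split_ifs with h
      · exact hG
      · exact Nat.pos_of_ne_zero fun h0 => h (Nat.dvd_of_mod_eq_zero h0)
    obtain ⟨f, hf, f', hf', hne⟩ := Finset.one_lt_card.1 (by omega : 1 < T.card)
    refine ⟨f, hf, f', hf', fun heq => ?_⟩
    have hTne : (e f).1 ≠ (e f').1 := fun h => hne (huniq f f' k s (hTs f hf) (hTs f' hf') h)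
    obtain ⟨k', hk', h1, h2⟩ := hsep s k _ _ (hsome f k s (hTs f hf))
      (hsome f' k s (hTs f' hf')) hTne
    have : k' ∈ pdaIntCols P s f' := heq ▸ (hint s f k').2 ⟨hk', h1⟩
    exact ((hint s f' k').1 this).2 h2

/-- The number of `n`-subsets `V` with `T ⊆ V` and `k ∉ V`. -/
theorem card_supersets_avoiding {κ : Type*} [Fintype κ] [DecidableEq κ] (T : Finset κ) (k : κ)
    (hk : k ∉ T) (n : ℕ) (hn : T.card ≤ n) :
    ((Finset.powersetCard n (Finset.univ : Finset κ)).filter fun V => T ⊆ V ∧ k ∉ V).card =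
      (Fintype.card κ - 1 - T.card).choose (n - T.card) := by
  have hc : (Finset.univ \ insert k T : Finset κ).card = Fintype.card κ - 1 - T.card := by
    rw [Finset.card_sdiff_of_subset (Finset.subset_univ _), Finset.card_insert_of_notMem hk,
      Finset.card_univ]
    omega
  rw [← hc, ← Finset.card_powersetCard]
  refine Finset.card_nbij' (fun V => V \ T) (fun A => A ∪ T) ?_ ?_ ?_ ?_
  · intro V hV
    simp only [Finset.coe_filter, Finset.mem_powersetCard, Set.mem_ofPred_eq] at hV
    simp only [Finset.mem_coe, Finset.mem_powersetCard]
    refine ⟨fun x hx => ?_, by rw [Finset.card_sdiff_of_subset hV.2.1, hV.1.2]⟩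
    simp only [Finset.mem_sdiff, Finset.mem_univ, Finset.mem_insert, true_and] at hx ⊢
    rintro (rfl | h)
    · exact hV.2.2 hx.1
    · exact hx.2 h
  · intro A hA
    simp only [Finset.mem_coe, Finset.mem_powersetCard] at hA
    have hd : Disjoint A T := Finset.disjoint_left.2 fun x hx hxT => by
      have := hA.1 hx
      simp [hxT] at this
    have hkA : k ∉ A := fun h => by simpa using hA.1 h
    simp only [Finset.coe_filter, Finset.mem_powersetCard, Set.mem_ofPred_eq, Finset.subset_univ,
      true_and, Finset.mem_union, hkA, hk, or_self, not_false_eq_true, and_true]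
    refine ⟨?_, Finset.subset_union_right⟩
    rw [Finset.card_union_of_disjoint hd, hA.2]
    omega
  · intro V hV
    simp only [Finset.coe_filter, Set.mem_ofPred_eq] at hV
    exact Finset.sdiff_union_of_subset hV.2.1
  · intro A hA
    simp only [Finset.mem_coe, Finset.mem_powersetCard] at hA
    have hd : Disjoint A T := Finset.disjoint_left.2 fun x hx hxT => by
      have := hA.1 hx
      simp [hxT] at this
    exact Finset.union_sdiff_cancel_right hd

/-- The number of `n`-subsets containing a given element. -/
theorem card_subtype_card_eq_mem {κ : Type*} [Fintype κ] [DecidableEq κ] (k : κ) (n : ℕ)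
    (hn : 0 < n) :
    (Finset.univ.filter fun T : {T : Finset κ // T.card = n} => k ∈ T.1).card =
      (Fintype.card κ - 1).choose (n - 1) := by
  have hc : (Finset.univ.erase k : Finset κ).card = Fintype.card κ - 1 := by
    rw [Finset.card_erase_of_mem (Finset.mem_univ _), Finset.card_univ]
  rw [← hc, ← Finset.card_powersetCard]
  refine Finset.card_bij (fun T _ => T.1.erase k) ?_ ?_ ?_
  · intro T hT
    have hT := (Finset.mem_filter.1 hT).2
    rw [Finset.mem_powersetCard, Finset.card_erase_of_mem hT, T.2]
    exact ⟨Finset.erase_subset_erase _ (Finset.subset_univ _), rfl⟩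
  · intro T hT T' hT' h
    have hT := (Finset.mem_filter.1 hT).2
    have hT' := (Finset.mem_filter.1 hT').2
    apply Subtype.ext
    rw [← Finset.insert_erase hT, ← Finset.insert_erase hT', h]
  · intro A hA
    rw [Finset.mem_powersetCard] at hA
    have hkA : k ∉ A := fun h => by simpa using hA.1 h
    refine ⟨⟨insert k A, ?_⟩, by simp, Finset.erase_insert hkA⟩
    rw [Finset.card_insert_of_notMem hkA, hA.2]
    omega

/-- The incidence relation behind the hybrid array. Symbols are triples of a `(v + 1)`-subset `U`,
a group `g`, and a label `(w, y)`; columns are pairs of a group and a point. Inside `U`, the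
symbol is used in every group; outside `U`, it is used only in group `g`, in at most `τ₂` columns,
each imitating the column of some `j ∈ U` via the permutation attached to `U.erase j`. -/
theorem exists_hybrid_rel {κ : Type*} [Fintype κ] [DecidableEq κ] {m t v τ₂ G c W l Y Q : ℕ}
    (hG : 0 < G) (hm : 0 < m) (hW : 0 < W) (hY : 0 < Y) (htv : t ≤ v)
    (hwin : v.choose t * c = W * G) (hcW : c ≤ W)
    (hslots : (v + 1) * (W * l) = W * Y * τ₂) (hQ : (v + 1) * Q ≤ W * Y)
    (hshift : W * l ≤ Q * (Fintype.card κ - (v + 1))) :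
    ∃ Rel : {U : Finset κ // U.card = v + 1} × Fin m × (Fin W × Fin Y) → Fin m × κ →
        {T : Finset κ // T.card = t} → Prop,
      (∀ s k T, Rel s k T → k.2 ∉ T.1) ∧
      (∀ k T, k.2 ∉ T.1 → Nat.card {s // Rel s k T} =
        (Fintype.card κ - 1 - t).choose (v - t) * (c * (m * Y + l))) ∧
      (∀ s k, Nat.card {T // Rel s k T} ≤ G) ∧
      (∀ s, ∃ k T, Rel s k T) ∧
      (∀ s k T, Rel s k T → ∃ D : Finset (Fin m × κ), D.card ≤ m * (v + 1 - t) + τ₂ ∧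
        ∀ k', k'.2 ∉ T.1 → (∃ T', Rel s k' T') → k' ∈ D) ∧
      ∀ s k T T', Rel s k T → Rel s k T' → T ≠ T' →
        ∃ k', (∃ T'', Rel s k' T'') ∧ k'.2 ∉ T.1 ∧ k'.2 ∈ T'.1 := by
  classical
  have hcover : ∀ V : Finset κ, ∃ 𝒲 : Fin W → Finset (Finset κ), V.card = v →
      (∀ w, 𝒲 w ⊆ V.powersetCard t) ∧ (∀ w, (𝒲 w).card = G) ∧
      ∀ T ∈ V.powersetCard t, (Finset.univ.filter fun w => T ∈ 𝒲 w).card = c := by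
    intro V
    by_cases hV : V.card = v
    · obtain ⟨𝒲, h⟩ := exists_uniform_cover (V.powersetCard t) c W G hW
        (by rw [Finset.card_powersetCard, hV, hwin]) hcW
      exact ⟨𝒲, fun _ => h⟩
    · exact ⟨fun _ => ∅, fun h => absurd h hV⟩
  choose 𝒲 h𝒲 using hcover
  have hperm : ∀ V : Finset κ, ∃ ψ : Fin W × Fin l → Equiv.Perm κ, V.card = v →
      (∀ r x, ψ r x ∈ Vᶜ ↔ x ∈ Vᶜ) ∧ (∀ r, ∀ x ∈ Vᶜ, ψ r x ≠ x) ∧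
      ∀ x, ∀ y ∈ Vᶜ, (Finset.univ.filter fun r => ψ r x = y).card ≤ Q := by
    intro V
    by_cases hV : V.card = v
    · obtain ⟨ψ, h⟩ := exists_spread_derangements (ι := Fin W × Fin l) Vᶜ Q (by
        rw [Finset.card_compl, hV, Nat.sub_sub]
        simpa using hshift)
      exact ⟨ψ, fun _ => h⟩
    · exact ⟨fun _ => 1, fun h => absurd h hV⟩
  choose ψ hψ using hperm
  have hcardErase : ∀ U : Finset κ, U.card = v + 1 → ∀ j ∈ U, (U.erase j).card = v := by
    intro U hU j hj
    rw [Finset.card_erase_of_mem hj, hU, Nat.add_sub_cancel]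
  have : Nonempty (Fin W × Fin Y) := ⟨(⟨0, hW⟩, ⟨0, hY⟩)⟩
  have hbins : ∀ U : Finset κ, ∃ a : κ × (Fin W × Fin l) → Fin W × Fin Y, U.card = v + 1 →
      (∀ x, ((U ×ˢ Finset.univ).filter fun p => a p = x).card = τ₂) ∧
      ∀ p ∈ U ×ˢ (Finset.univ : Finset (Fin W × Fin l)), ∀ p' ∈ U ×ˢ Finset.univ, a p = a p' →
        (ψ (U.erase p.1) p.2).symm p.1 = (ψ (U.erase p'.1) p'.2).symm p'.1 → p = p' := by
    intro U
    by_cases hU : U.card = v + 1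
    · obtain ⟨a, h⟩ := exists_balanced_bins (B := Fin W × Fin Y)
        (U ×ˢ (Finset.univ : Finset (Fin W × Fin l)))
        (fun p => (ψ (U.erase p.1) p.2).symm p.1) τ₂ (by simp [hU, hslots]) (by
          intro k
          have hle : ((U ×ˢ (Finset.univ : Finset (Fin W × Fin l))).filter fun p =>
              (ψ (U.erase p.1) p.2).symm p.1 = k).card ≤
              (U.sigma fun j => Finset.univ.filter fun r => ψ (U.erase j) r k = j).card := by
            refine Finset.card_le_card_of_injOn (fun p => ⟨p.1, p.2⟩) ?_ ?_
            · intro p hp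
              simp only [Finset.coe_filter, Finset.mem_product, Set.mem_ofPred_eq,
                Equiv.symm_apply_eq] at hp
              simp [hp.1.1, ← hp.2]
            · rintro ⟨j, r⟩ _ ⟨j', r'⟩ _ h
              simpa using h
          refine hle.trans ?_
          rw [Finset.card_sigma]
          refine (Finset.sum_le_card_nsmul _ _ Q fun j hj =>
            (hψ _ (hcardErase U hU j hj)).2.2 k j (by simp)).trans ?_
          simpa [hU] using hQ)
      exact ⟨a, fun _ => h⟩
    · exact ⟨fun _ => Classical.arbitrary _, fun h => absurd h hU⟩
  choose a ha using hbins
  let Rel₁ : {U : Finset κ // U.card = v + 1} × Fin m × (Fin W × Fin Y) → Fin m × κ →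
      {T : Finset κ // T.card = t} → Prop :=
    fun s k T => k.2 ∈ s.1.1 ∧ T.1 ∈ 𝒲 (s.1.1.erase k.2) s.2.2.1
  let Rel₂ : {U : Finset κ // U.card = v + 1} × Fin m × (Fin W × Fin Y) → Fin m × κ →
      {T : Finset κ // T.card = t} → Prop :=
    fun s k T => k.1 = s.2.1 ∧ k.2 ∉ s.1.1 ∧ ∃ p ∈ s.1.1 ×ˢ (Finset.univ : Finset (Fin W × Fin l)),
      ψ (s.1.1.erase p.1) p.2 k.2 = p.1 ∧ a s.1.1 p = s.2.2 ∧ T.1 ∈ 𝒲 (s.1.1.erase p.1) p.2.1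
  have hsub : ∀ V w T, V.card = v → T ∈ 𝒲 V w → T ⊆ V := by
    intro V w T hV hT
    exact (Finset.mem_powersetCard.1 ((h𝒲 V hV).1 w hT)).1
  have hTU : ∀ s k T, Rel₁ s k T ∨ Rel₂ s k T → T.1 ⊆ s.1.1 := by
    rintro s k T (⟨hk, hT⟩ | ⟨_, _, p, hp, _, _, hT⟩)
    · exact (hsub _ _ _ (hcardErase _ s.1.2 _ hk) hT).trans (Finset.erase_subset _ _)
    · exact (hsub _ _ _ (hcardErase _ s.1.2 _ (Finset.mem_product.1 hp).1) hT).trans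
        (Finset.erase_subset _ _)
  have hocc : ∀ s g, ∀ k ∈ s.1.1, ∃ T, Rel₁ s (g, k) T := by
    intro s g k hk
    obtain ⟨h1, h2, _⟩ := h𝒲 _ (hcardErase _ s.1.2 _ hk)
    obtain ⟨T, hT⟩ := Finset.card_pos.1 ((h2 s.2.2.1).symm ▸ hG)
    exact ⟨⟨T, (Finset.mem_powersetCard.1 (h1 _ hT)).2⟩, hk, hT⟩
  refine ⟨fun s k T => Rel₁ s k T ∨ Rel₂ s k T, ?_, ?_, ?_, ?_, ?_, ?_⟩
  · rintro s k T h hkT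
    have hkU := hTU s k T h hkT
    obtain ⟨hk, hT⟩ | ⟨_, hk, _⟩ := h
    · exact Finset.notMem_erase _ _ (hsub _ _ _ (hcardErase _ s.1.2 _ hk) hT hkT)
    · exact hk hkU
  · rintro ⟨g, k⟩ ⟨T, rfl⟩ hk
    simp only at hk
    have hdisj : ∀ s, Rel₁ s (g, k) ⟨T, rfl⟩ → ¬ Rel₂ s (g, k) ⟨T, rfl⟩ :=
      fun s h h' => h'.2.1 h.1
    set 𝒱 := (Finset.powersetCard v (Finset.univ : Finset κ)).filter fun V => T ⊆ V ∧ k ∉ V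
      with h𝒱
    have hmem𝒱 : ∀ V, V ∈ 𝒱 ↔ V.card = v ∧ T ⊆ V ∧ k ∉ V := by
      intro V
      simp [h𝒱, Finset.mem_powersetCard]
    have hV𝒱 : 𝒱.card = (Fintype.card κ - 1 - T.card).choose (v - T.card) :=
      card_supersets_avoiding T k hk v htv
    have hcov : ∀ V ∈ 𝒱, (Finset.univ.filter fun w => T ∈ 𝒲 V w).card = c := by
      intro V hV
      obtain ⟨h1, h2, h3⟩ := (hmem𝒱 V).1 hV
      exact (h𝒲 V h1).2.2 T (Finset.mem_powersetCard.2 ⟨h2, rfl⟩)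
    have h1 : (Finset.univ.filter fun s => Rel₁ s (g, k) ⟨T, rfl⟩).card = 𝒱.card * (c * (m * Y)) := by
      have : (𝒱.sigma fun V => (Finset.univ.filter fun w => T ∈ 𝒲 V w) ×ˢ
          (Finset.univ : Finset (Fin m × Fin Y))).card =
          (Finset.univ.filter fun s => Rel₁ s (g, k) ⟨T, rfl⟩).card := by
        refine Finset.card_bij (fun q hq => (⟨insert k q.1, ?_⟩, q.2.2.1, (q.2.1, q.2.2.2))) ?_ ?_ ?_
        · obtain ⟨h1, h2, h3⟩ := (hmem𝒱 _).1 (Finset.mem_sigma.1 hq).1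
          rw [Finset.card_insert_of_notMem h3, h1]
        · rintro ⟨V, w, g', y⟩ hq
          obtain ⟨hV, hw⟩ := Finset.mem_sigma.1 hq
          obtain ⟨h1, h2, h3⟩ := (hmem𝒱 _).1 hV
          simp only [Finset.mem_product, Finset.mem_filter, Finset.mem_univ, true_and, and_true] at hw
          simp only at h3
          simpa [Rel₁, h3] using hw
        · rintro ⟨V, w, g', y⟩ hq ⟨V', w', g'', y'⟩ hq' h
          have h3 := ((hmem𝒱 _).1 (Finset.mem_sigma.1 hq).1).2.2
          have h3' := ((hmem𝒱 _).1 (Finset.mem_sigma.1 hq').1).2.2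
          simp only [Prod.mk.injEq, Subtype.mk.injEq] at h h3 h3'
          obtain ⟨h, rfl, rfl, rfl⟩ := h
          obtain rfl : V = V' := by
            rw [← Finset.erase_insert h3, ← Finset.erase_insert h3', h]
          rfl
        · rintro ⟨⟨U, hU⟩, g', w, y⟩ hs
          obtain ⟨hkU, hT⟩ := (Finset.mem_filter.1 hs).2
          simp only at hkU hT
          refine ⟨⟨U.erase k, w, g', y⟩, ?_, ?_⟩
          · simp only [Finset.mem_sigma, Finset.mem_product, Finset.mem_filter, Finset.mem_univ,
              true_and, and_true, hmem𝒱]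
            exact ⟨⟨hcardErase U hU k hkU, hsub _ _ _ (hcardErase U hU k hkU) hT,
              Finset.notMem_erase _ _⟩, hT⟩
          · simp [Finset.insert_erase hkU]
      rw [← this, Finset.card_sigma, Finset.sum_const_nat (m := c * (m * Y))]
      intro V hV
      rw [Finset.card_product, hcov V hV]
      simp
    have h2 : (Finset.univ.filter fun s => Rel₂ s (g, k) ⟨T, rfl⟩).card = 𝒱.card * (c * l) := by
      have : (𝒱.sigma fun V => (Finset.univ.filter fun w => T ∈ 𝒲 V w) ×ˢ
          (Finset.univ : Finset (Fin l))).card =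
          (Finset.univ.filter fun s => Rel₂ s (g, k) ⟨T, rfl⟩).card := by
        have hins : ∀ V ∈ 𝒱, ∀ r, ψ V r k ∉ V ∧ k ∉ insert (ψ V r k) V := by
          intro V hV r
          obtain ⟨h1, h2, h3⟩ := (hmem𝒱 _).1 hV
          have hj := ((hψ V h1).1 r k).2 (Finset.mem_compl.2 h3)
          have hne := (hψ V h1).2.1 r k (Finset.mem_compl.2 h3)
          refine ⟨Finset.mem_compl.1 hj, ?_⟩
          simp [h3, hne.symm]
        refine Finset.card_bij (fun q hq => (⟨insert (ψ q.1 q.2 k) q.1, ?_⟩, g,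
          a (insert (ψ q.1 q.2 k) q.1) (ψ q.1 q.2 k, q.2))) ?_ ?_ ?_
        · have hV := (Finset.mem_sigma.1 hq).1
          rw [Finset.card_insert_of_notMem (hins _ hV _).1, ((hmem𝒱 _).1 hV).1]
        · rintro ⟨V, r⟩ hq
          obtain ⟨hV, hw⟩ := Finset.mem_sigma.1 hq
          simp only at hV hw
          refine Finset.mem_filter.2 ⟨Finset.mem_univ _, rfl, (hins V hV r).2,
            (ψ V r k, r), ?_, ?_, rfl, ?_⟩
          · simp
          · simp [Finset.erase_insert (hins V hV r).1]
          · simp only [Finset.mem_product, Finset.mem_filter, Finset.mem_univ, true_and,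
              and_true] at hw
            simpa [Finset.erase_insert (hins V hV r).1] using hw
        · rintro ⟨V, r⟩ hq ⟨V', r'⟩ hq' h
          have hV : V ∈ 𝒱 := (Finset.mem_sigma.1 hq).1
          have hV' : V' ∈ 𝒱 := (Finset.mem_sigma.1 hq').1
          simp only [Prod.mk.injEq, Subtype.mk.injEq, true_and] at h
          obtain ⟨hU, hax⟩ := h
          have e1 := Finset.erase_insert (hins V hV r).1
          have e2 := Finset.erase_insert (hins V' hV' r').1
          have hp := (ha (insert (ψ V r k) V)
            (by rw [Finset.card_insert_of_notMem (hins V hV r).1, ((hmem𝒱 V).1 hV).1])).2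
            (ψ V r k, r) (by simp) (ψ V' r' k, r') (by simp [hU]) (by rw [hax, hU])
            (by
              simp only
              rw [e1, hU, e2, Equiv.symm_apply_apply, Equiv.symm_apply_apply])
          obtain ⟨hj, rfl⟩ := Prod.mk.inj hp
          obtain rfl : V = V' := by rw [← e1, ← e2, hU, hj]
          rfl
        · rintro ⟨⟨U, hU⟩, g', x⟩ hs
          obtain ⟨hg, hkU, ⟨j, r⟩, hp, hj, hax, hT⟩ := (Finset.mem_filter.1 hs).2
          simp only at hg hkU hp hj hax hT
          have hjU : j ∈ U := (Finset.mem_product.1 hp).1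
          refine ⟨⟨U.erase j, r⟩, ?_, ?_⟩
          · simp only [Finset.mem_sigma, Finset.mem_product, Finset.mem_filter, Finset.mem_univ,
              true_and, and_true, hmem𝒱]
            exact ⟨⟨hcardErase U hU j hjU, hsub _ _ _ (hcardErase U hU j hjU) hT,
              fun h => hkU (Finset.mem_of_mem_erase h)⟩, hT⟩
          · simp [hj, Finset.insert_erase hjU, hax, hg]
      rw [← this, Finset.card_sigma, Finset.sum_const_nat (m := c * l)]
      intro V hV
      rw [Finset.card_product, hcov V hV]
      simp
    rw [Nat.card_eq_fintype_card, Fintype.card_subtype, Finset.filter_or,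
      Finset.card_union_of_disjoint, h1, h2, hV𝒱]
    · ring
    · exact Finset.disjoint_filter.2 fun s _ h => hdisj s h
  · intro s k
    rw [Nat.card_eq_fintype_card, Fintype.card_subtype]
    have hbound : ∀ V w, V.card = v → ∀ 𝒯 : Finset {T : Finset κ // T.card = t},
        (∀ T ∈ 𝒯, T.1 ∈ 𝒲 V w) → 𝒯.card ≤ G := by
      intro V w hV 𝒯 h
      rw [← (h𝒲 V hV).2.1 w]
      exact Finset.card_le_card_of_injOn Subtype.val h Subtype.val_injective.injOn
    by_cases hk : k.2 ∈ s.1.1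
    · refine hbound _ s.2.2.1 (hcardErase _ s.1.2 _ hk) _ fun T hT => ?_
      obtain h | h := (Finset.mem_filter.1 hT).2
      · exact h.2
      · exact absurd hk h.2.1
    · rcases Finset.eq_empty_or_nonempty
        (Finset.univ.filter fun T => Rel₁ s k T ∨ Rel₂ s k T) with h0 | ⟨T₀, hT₀⟩
      · rw [h0]
        simp
      · obtain h | ⟨_, _, p, hp, hpk, hpa, _⟩ := (Finset.mem_filter.1 hT₀).2
        · exact absurd h.1 hk
        refine hbound _ p.2.1 (hcardErase _ s.1.2 _ (Finset.mem_product.1 hp).1) _ fun T hT => ?_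
        obtain h | ⟨_, _, p', hp', hpk', hpa', hT'⟩ := (Finset.mem_filter.1 hT).2
        · exact absurd h.1 hk
        have := (ha _ s.1.2).2 p hp p' hp' (hpa.trans hpa'.symm)
          (((Equiv.symm_apply_eq _).2 hpk.symm).trans ((Equiv.symm_apply_eq _).2 hpk'.symm).symm)
        rw [this]
        exact hT'
  · intro s
    obtain ⟨k, hk⟩ := Finset.card_pos.1 (s.1.2.symm ▸ Nat.succ_pos v : 0 < s.1.1.card)
    obtain ⟨T, hT⟩ := hocc s ⟨0, hm⟩ k hk
    exact ⟨_, T, Or.inl hT⟩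
  · intro s k T hT
    refine ⟨(Finset.univ ×ˢ (s.1.1 \ T.1)) ∪ ((s.1.1 ×ˢ Finset.univ).filter fun p =>
      a s.1.1 p = s.2.2).image fun p => (s.2.1, (ψ (s.1.1.erase p.1) p.2).symm p.1), ?_, ?_⟩
    · refine (Finset.card_union_le _ _).trans (Nat.add_le_add ?_ ?_)
      · rw [Finset.card_product, Finset.card_sdiff_of_subset (hTU s k T hT), s.1.2, T.2]
        simp
      · refine Finset.card_image_le.trans ?_
        rw [(ha _ s.1.2).1]
    · rintro k' hk' ⟨T', ⟨hk, _⟩ | ⟨hg, _, p, hp, hpk, hpa, _⟩⟩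
      · exact Finset.mem_union_left _ (by simp [hk, hk'])
      · refine Finset.mem_union_right _ (Finset.mem_image.2
          ⟨p, Finset.mem_filter.2 ⟨hp, hpa⟩, Prod.ext hg.symm ?_⟩)
        exact (Equiv.symm_apply_eq _).2 hpk.symm
  · intro s k T T' hT hT' hne
    obtain ⟨x, hx', hx⟩ : ∃ x ∈ T'.1, x ∉ T.1 := by
      by_contra! h
      exact hne (Subtype.ext (Finset.eq_of_subset_of_card_le h (by rw [T.2, T'.2])).symm)
    obtain ⟨T'', hT''⟩ := hocc s k.1 x (hTU s k T' hT' hx')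
    exact ⟨(k.1, x), ⟨T'', Or.inl hT''⟩, hx, hx'⟩

/-- The hybrid array, with rows, columns and symbols numbered. -/
theorem exists_hybrid_isMIMOPDA {L K m t v τ₂ G c W l Y Q C F S : ℕ}
    (hG : 0 < G) (hm : 0 < m) (hW : 0 < W) (hY : 0 < Y) (ht : 0 < t) (htv : t ≤ v)
    (hwin : v.choose t * c = W * G) (hcW : c ≤ W)
    (hslots : (v + 1) * (W * l) = W * Y * τ₂) (hQ : (v + 1) * Q ≤ W * Y)
    (hshift : W * l ≤ Q * (K - (v + 1))) (hcd : m * (v + 1 - t) + τ₂ ≤ cdiv L G)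
    (hC : C = (K - 1 - t).choose (v - t) * (c * (m * Y + l)))
    (hF : F = C * K.choose t) (hS : S = K.choose (v + 1) * (m * (W * Y))) :
    ∃ P : Fin F → Fin (m * K) → Option (Fin S),
      IsMIMOPDA G L (m * K) F (C * (K - 1).choose (t - 1)) S P := by
  classical
  obtain ⟨Rel, hns, hcount, hrow, hocc, hcols, hsep⟩ :=
    exists_hybrid_rel (κ := Fin K) hG hm hW hY htv hwin hcW hslots hQ (by simpa using hshift)
  let ec : Fin (m * K) ≃ Fin m × Fin K := finProdFinEquiv.symm
  let es : Fin S ≃ {U : Finset (Fin K) // U.card = v + 1} × Fin m × (Fin W × Fin Y) :=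
    Fintype.equivOfCardEq (by simp [hS, Fintype.card_finset_len])
  let er : Fin F ≃ {T : Finset (Fin K) // T.card = t} × Fin C :=
    Fintype.equivOfCardEq (by simp [hF, Fintype.card_finset_len, mul_comm])
  have := exists_isMIMOPDA_of_rel (L := L) (z := (K - 1).choose (t - 1)) hG er
    (fun k T => (ec k).2 ∈ T.1) (fun s k T => Rel (es s) (ec k) T)
    (fun k => by simpa using card_subtype_card_eq_mem (ec k).2 t ht)
    (fun s k T h => hns _ _ _ h)
    (fun k T h => by
      rw [← Fintype.card_subtype, ← Nat.card_eq_fintype_card, hC]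
      have h1 := hcount (ec k) T h
      rw [Fintype.card_fin] at h1
      rw [← h1]
      exact Nat.card_congr (es.subtypeEquiv fun _ => Iff.rfl))
    (fun s k => by
      rw [← Fintype.card_subtype, ← Nat.card_eq_fintype_card]
      exact hrow _ _)
    (fun s => by
      obtain ⟨k, T, h⟩ := hocc (es s)
      exact ⟨ec.symm k, T, by simpa using h⟩)
    (fun s k T h => by
      obtain ⟨D, hD, hD'⟩ := hcols _ _ _ h
      refine ⟨D.map ec.symm.toEmbedding, by simpa using hD.trans hcd, fun k' hk' hT' => ?_⟩
      exact Finset.mem_map_equiv.2 (hD' _ hk' hT'))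
    (fun s k T T' h h' hne => by
      obtain ⟨k', ⟨T'', hT''⟩, h1, h2⟩ := hsep _ _ _ _ h h' hne
      exact ⟨ec.symm k', ⟨T'', by simpa using hT''⟩, by simpa using h1, by simpa using h2⟩)
  simpa only [Fintype.card_fin] using this

/-- The integer entries of the hybrid array, counted by columns and by symbols. -/
theorem hybrid_count {K t v m τ₂ c W G l q : ℕ} (ht : 0 < t) (htv : t ≤ v) (hvK : v < K)
    (hwin : v.choose t * c = W * G) (hv : v + 1 = q * τ₂) :
    m * K * ((K - 1 - t).choose (v - t) * (c * (m * (l * q) + l)) * K.choose t -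
        (K - 1 - t).choose (v - t) * (c * (m * (l * q) + l)) * (K - 1).choose (t - 1)) =
      K.choose (v + 1) * (m * (W * (l * q))) * (G * (m * (v + 1) + τ₂)) := by
  obtain ⟨k, rfl⟩ : ∃ k, K = k + 1 := ⟨K - 1, by omega⟩
  obtain ⟨s, rfl⟩ : ∃ s, t = s + 1 := ⟨t - 1, by omega⟩
  have h1 := Nat.choose_mul (n := k) (k := v) (s := s + 1) htv
  have h2 := Nat.add_one_mul_choose_eq k v
  simp only [Nat.add_sub_cancel]
  rw [← Nat.mul_sub, Nat.choose_succ_succ, Nat.add_sub_cancel_left]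
  calc m * (k + 1) * ((k - (s + 1)).choose (v - (s + 1)) * (c * (m * (l * q) + l)) *
        k.choose (s + 1))
      = m * (k + 1) * (c * (m * (l * q) + l)) *
        (k.choose (s + 1) * (k - (s + 1)).choose (v - (s + 1))) := by ring
    _ = m * (c * (m * (l * q) + l)) * v.choose (s + 1) * ((k + 1) * k.choose v) := by
        rw [← h1]; ring
    _ = m * (m * (l * q) + l) * (k + 1).choose (v + 1) * (v + 1) * (v.choose (s + 1) * c) := by
        rw [h2]; ring
    _ = _ := by rw [hwin, hv]; ring

theorem succ_mul_le_two_mul_choose {v n : ℕ} (hn : 0 < n) (hv : n + 1 ≤ v) :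
    (n + 1) * n ≤ 2 * v.choose (n - 1) := by
  have h : (n + 1).choose (n - 1) * 2 = (n + 1) * n := by
    rw [Nat.choose_symm_of_eq_add (by omega : n + 1 = (n - 1) + 2), Nat.choose_two_right,
      Nat.add_sub_cancel]
    exact Nat.div_mul_cancel (mul_comm n (n + 1) ▸ (Nat.even_mul_succ_self n).two_dvd)
  rw [← h, mul_comm]
  exact Nat.mul_le_mul_left _ (Nat.choose_le_choose _ hv)

/-- Theorem 6, hybrid MIMO-PDA: with `τ₁ = ⌈L₁/G⌉`, `τ = ⌈L/G⌉`,
`m = ⌊τ/τ₁⌋ ≥ 1`, `τ₂ = τ - mτ₁ > 0`, `τ₁ ∣ t₁`, `τ₁ ∣ K₁`, `t₁ + τ₁ < K₁`,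
`τ₂ ∣ (t₁ + τ₁)` and `2G ≤ C(t₁+τ₁-1, t₁)`, there exists a `(G, L, mK₁, F, Z, S)`
MIMO-PDA with the stated parameters whose sum-DoF equals
`min{G·mK₁, G·m·t₁ + G⌈L/G⌉}`. -/
theorem statement3 (G L₁ L K₁ t₁ τ₁ τ m τ₂ Λ₁ Λ₂ Λ₃ F Z S : ℕ)
    (hG : 0 < G) (hL₁ : 0 < L₁) (hL : 0 < L) (hK₁ : 0 < K₁) (ht₁pos : 0 < t₁)
    (hτ₁ : τ₁ = cdiv L₁ G) (hτ : τ = cdiv L G)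
    (hm : m = τ / τ₁) (hm1 : 1 ≤ m)
    (hτ₂ : τ₂ = τ - m * τ₁) (hτ₂pos : 0 < τ₂)
    (hd1 : τ₁ ∣ t₁) (hd2 : τ₁ ∣ K₁) (hlt : t₁ + τ₁ < K₁) (hd3 : τ₂ ∣ (t₁ + τ₁))
    (hbin : 2 * G ≤ (t₁ + τ₁ - 1).choose t₁)
    (hΛ₁ : Λ₁ = (K₁ - t₁ - 1).choose (τ₁ - 1))
    (hΛ₂ : Λ₂ = (t₁ + τ₁ - 1).choose (τ₁ - 1))
    (hΛ₃ : Λ₃ = (t₁ + τ₁ - 1).choose (τ₂ - 1))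
    (hF : F = G * Λ₁ * Λ₃ / Nat.gcd G Λ₂ * (m * (t₁ + τ₁) / τ₂ + 1) * K₁.choose t₁)
    (hZ : Z = G * Λ₁ * Λ₃ / Nat.gcd G Λ₂ * (m * (t₁ + τ₁) / τ₂ + 1)
        * (K₁ - 1).choose (t₁ - 1))
    (hS : S = m * Λ₂ * Λ₃ / Nat.gcd G Λ₂ * ((t₁ + τ₁) / τ₂) * K₁.choose (t₁ + τ₁)) :
    ∃ P : Fin F → Fin (m * K₁) → Option (Fin S),
      IsMIMOPDA G L (m * K₁) F Z S P ∧
      sumDoF (m * K₁) F Z S = ((min (G * (m * K₁)) (G * m * t₁ + G * cdiv L G) : ℕ) : ℚ) := by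
  rw [← hτ]
  have hτ₁pos : 0 < τ₁ := Nat.pos_of_ne_zero fun h => by simp [h] at hm; omega
  have hmod : τ₂ = τ % τ₁ := by
    rw [hτ₂, hm, Nat.mod_eq_sub_div_mul]
  have hτ₂lt : τ₂ < τ₁ := hmod ▸ Nat.mod_lt _ hτ₁pos
  have hτeq : m * τ₁ + τ₂ = τ := by omega
  obtain ⟨v, hv⟩ : ∃ v, t₁ + τ₁ = v + 1 := ⟨t₁ + τ₁ - 1, by omega⟩
  have hgap : τ₁ ≤ K₁ - (v + 1) := by
    rw [← hv]
    exact Nat.le_of_dvd (by omega) (Nat.dvd_sub hd2 (Nat.dvd_add hd1 dvd_rfl))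
  have ht₁ : τ₁ ≤ t₁ := Nat.le_of_dvd ht₁pos hd1
  rw [hv] at hlt hd3 hbin hΛ₂ hΛ₃ hF hZ hS
  rw [Nat.add_sub_cancel] at hbin hΛ₂ hΛ₃
  obtain ⟨q, hq⟩ := hd3
  have hΛ₂' : v.choose t₁ = Λ₂ := by
    rw [hΛ₂, ← Nat.choose_symm_of_eq_add (by omega : v = t₁ + (τ₁ - 1))]
  have hΛ₃pos : 0 < Λ₃ := hΛ₃ ▸ Nat.choose_pos (by omega)
  have hqpos : 0 < q := Nat.pos_of_ne_zero fun h => by simp [h] at hq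
  obtain ⟨c, hc⟩ := Nat.gcd_dvd_left G Λ₂
  obtain ⟨W, hW⟩ := Nat.gcd_dvd_right G Λ₂
  have hγ : 0 < Nat.gcd G Λ₂ := Nat.gcd_pos_of_pos_left _ hG
  generalize Nat.gcd G Λ₂ = γ at *
  have hcW : 2 * c ≤ W := by
    rw [hΛ₂', hc, hW] at hbin
    exact Nat.le_of_mul_le_mul_left (by linarith) hγ
  have hcpos : 0 < c := Nat.pos_of_ne_zero fun h => by simp [h] at hc; omega
  have hwin : v.choose t₁ * c = W * G := by
    rw [hΛ₂', hW]
    rw [hc]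
    ring
  have hslot : (τ₂ + 1) * τ₂ ≤ W * Λ₃ := by
    calc (τ₂ + 1) * τ₂ ≤ 2 * v.choose (τ₂ - 1) :=
          succ_mul_le_two_mul_choose hτ₂pos (by omega)
      _ ≤ W * Λ₃ := hΛ₃ ▸ Nat.mul_le_mul_right _ (by omega)
  set Q := W * Λ₃ / τ₂
  have hQτ : Q * τ₂ ≤ W * Λ₃ := Nat.div_mul_le_self _ _
  have hQlt : W * Λ₃ < (Q + 1) * τ₂ := by
    rw [mul_comm (Q + 1)]
    exact Nat.lt_mul_div_succ (W * Λ₃) hτ₂pos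
  have hQge : τ₂ + 1 ≤ Q := (Nat.le_div_iff_mul_le hτ₂pos).2 hslot
  have hC : G * Λ₁ * Λ₃ / γ * (m * (v + 1) / τ₂ + 1) =
      (K₁ - 1 - t₁).choose (v - t₁) * (c * (m * (Λ₃ * q) + Λ₃)) := by
    have h1 : G * Λ₁ * Λ₃ / γ = c * Λ₁ * Λ₃ := by
      rw [hc]
      exact Nat.div_eq_of_eq_mul_right hγ (by ring)
    have h2 : m * (v + 1) / τ₂ = m * q := by
      rw [hq]
      exact Nat.div_eq_of_eq_mul_right hτ₂pos (by ring)
    rw [h1, h2, hΛ₁, Nat.sub_right_comm, (by omega : τ₁ - 1 = v - t₁)]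
    ring
  have hF' : F = (K₁ - 1 - t₁).choose (v - t₁) * (c * (m * (Λ₃ * q) + Λ₃)) * K₁.choose t₁ := by
    rw [hF, hC]
  have hZ' : Z = (K₁ - 1 - t₁).choose (v - t₁) * (c * (m * (Λ₃ * q) + Λ₃)) *
      (K₁ - 1).choose (t₁ - 1) := by
    rw [hZ, hC]
  have hS' : S = K₁.choose (v + 1) * (m * (W * (Λ₃ * q))) := by
    rw [hS, hW, hq, Nat.mul_div_cancel_left _ hτ₂pos,
      Nat.div_eq_of_eq_mul_right hγ (by ring : m * (γ * W) * Λ₃ = γ * (m * W * Λ₃))]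
    ring
  have hvt : v + 1 - t₁ = τ₁ := by omega
  have hdof : m * K₁ * (F - Z) = S * (G * (m * (v + 1) + τ₂)) := by
    rw [hF', hZ', hS']
    exact hybrid_count ht₁pos (by omega) (by omega) hwin (by rw [hq, mul_comm])
  have hSpos : 0 < S := by
    rw [hS']
    have := Nat.choose_pos hlt.le
    have : 0 < W := by omega
    positivity
  have hmin : min (G * (m * K₁)) (G * m * t₁ + G * τ) = G * (m * (v + 1) + τ₂) := by
    have h1 : G * m * t₁ + G * τ = G * (m * (v + 1) + τ₂) := by
      rw [← hτeq, ← hv]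
      ring
    rw [h1]
    refine min_eq_right (Nat.mul_le_mul_left _ ?_)
    calc m * (v + 1) + τ₂ ≤ m * (v + 1) + m * τ₂ :=
          Nat.add_le_add_left (Nat.le_mul_of_pos_left _ hm1) _
      _ = m * (v + 1 + τ₂) := (mul_add _ _ _).symm
      _ ≤ m * K₁ := Nat.mul_le_mul_left _ (by omega)
  have hP := exists_hybrid_isMIMOPDA (L := L) (K := K₁) (Q := Q) hG hm1 (by omega : 0 < W)
    (by positivity : 0 < Λ₃ * q) ht₁pos (by omega : t₁ ≤ v) hwin (by omega)
    (by rw [hq]; ring) ?_ ?_ (by rw [hvt, hτeq, hτ]) rfl hF' hS'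
  · rw [← hZ'] at hP
    obtain ⟨P, hP⟩ := hP
    refine ⟨P, hP, ?_⟩
    rw [hmin, sumDoF, hdof, Nat.cast_mul, mul_div_cancel_left₀]
    exact_mod_cast hSpos.ne'
  · calc (v + 1) * Q = Q * τ₂ * q := by rw [hq]; ring
      _ ≤ W * Λ₃ * q := Nat.mul_le_mul_right _ hQτ
      _ = W * (Λ₃ * q) := mul_assoc _ _ _
  · calc W * Λ₃ ≤ Q * τ₂ + τ₂ := by linarith
      _ ≤ Q * (τ₂ + 1) := by linarith
      _ ≤ Q * (K₁ - (v + 1)) := Nat.mul_le_mul_left _ (by omega)
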